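/- Let W : [0,∞) → ℝ be continuous and satisfy |W(y)| ≤ C·e^{−2y} for all y ≥ 0 and some constant C > 0. Then the function h(y) = −Q′(y)·∫₀^y A(z)·W(z) dz − A(y)·∫_y^∞ Q′(z)·W(z) dz is twice continuously differentiable on (0,∞) and satisfies −h″(y) + h(y) − 3Q(y)²·h(y) = W(y) for every y > 0. -/

import Mathlib

open MeasureTheory

/-- The cubic NLS soliton profile. -/
noncomputable def Q (y : ℝ) : ℝ := Real.sqrt 2 / Real.cosh y

/-- The explicit odd-growth solution of the linearized equation. -/
noncomputable def A (y : ℝ) : ℝ :=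
  (Real.sqrt 2 / (4 * Real.cosh y)) * (3 * y * Real.tanh y + (Real.sinh y) ^ 2 - 2)

lemma hasDerivAt_Q (y : ℝ) :
    HasDerivAt Q (-(√2 * Real.sinh y / Real.cosh y ^ 2)) y := by
  have hc := (Real.cosh_pos y).ne'
  refine ((hasDerivAt_const y √2).div (Real.hasDerivAt_cosh y) hc).congr_deriv ?_
  ring

lemma deriv_Q : deriv Q = fun y => -(√2 * Real.sinh y / Real.cosh y ^ 2) :=
  funext fun y => (hasDerivAt_Q y).deriv

lemma hasDerivAt_deriv_Q (y : ℝ) :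
    HasDerivAt (deriv Q) (√2 * (Real.sinh y ^ 2 - 1) / Real.cosh y ^ 3) y := by
  rw [deriv_Q]
  have hc := (Real.cosh_pos y).ne'
  refine ((((Real.hasDerivAt_sinh y).const_mul √2).div
    ((Real.hasDerivAt_cosh y).pow 2) (pow_ne_zero 2 hc)).neg).congr_deriv ?_
  simp only [Pi.pow_apply]
  field_simp
  linear_combination -Real.cosh y * Real.cosh_sq y

/-- `Q′` solves the linearized equation. -/
lemma hasDerivAt_deriv_deriv_Q (y : ℝ) :
    HasDerivAt (fun y => √2 * (Real.sinh y ^ 2 - 1) / Real.cosh y ^ 3)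
      ((1 - 3 * Q y ^ 2) * deriv Q y) y := by
  have hc := (Real.cosh_pos y).ne'
  refine (((((Real.hasDerivAt_sinh y).pow 2).sub_const 1).const_mul √2).div
    ((Real.hasDerivAt_cosh y).pow 3) (pow_ne_zero 3 hc)).congr_deriv ?_
  simp only [deriv_Q, Q, div_pow, Real.sq_sqrt zero_le_two, Pi.pow_apply]
  field_simp
  push_cast
  linear_combination 3 * Real.sinh y * Real.cosh y ^ 2 * Real.cosh_sq y

lemma A_eq (y : ℝ) : A y = √2 / 4 * (3 * y * Real.sinh y / Real.cosh y ^ 2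
    + (Real.sinh y ^ 2 - 2) / Real.cosh y) := by
  have hc := (Real.cosh_pos y).ne'
  rw [A, Real.tanh_eq_sinh_div_cosh]
  field_simp
  ring

/-- The derivative of `A`. -/
noncomputable def A' (y : ℝ) : ℝ :=
  √2 / 4 * (3 * y * (1 - Real.sinh y ^ 2) / Real.cosh y ^ 3
    + Real.sinh y * (Real.sinh y ^ 2 + 7) / Real.cosh y ^ 2)

lemma hasDerivAt_A (y : ℝ) : HasDerivAt A (A' y) y := by
  rw [funext A_eq]
  have hc := (Real.cosh_pos y).ne'
  have hs := Real.hasDerivAt_sinh y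
  have hch := Real.hasDerivAt_cosh y
  refine ((((((hasDerivAt_id y).const_mul 3).mul hs).div (hch.pow 2) (pow_ne_zero 2 hc)).add
    (((hs.pow 2).sub_const 2).div hch hc)).const_mul (√2 / 4)).congr_deriv ?_
  simp only [A', id, Pi.pow_apply, Pi.mul_apply]
  field_simp
  push_cast
  have h2 := Real.cosh_sq y
  grind

/-- `A` solves the linearized equation. -/
lemma hasDerivAt_A' (y : ℝ) : HasDerivAt A' ((1 - 3 * Q y ^ 2) * A y) y := by
  have hc := (Real.cosh_pos y).ne'
  have hs := Real.hasDerivAt_sinh y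
  have hch := Real.hasDerivAt_cosh y
  refine ((((((hasDerivAt_id y).const_mul 3).mul ((hs.pow 2).const_sub 1)).div
    (hch.pow 3) (pow_ne_zero 3 hc)).add
    ((hs.mul ((hs.pow 2).add_const 7)).div (hch.pow 2)
      (pow_ne_zero 2 hc))).const_mul (√2 / 4)).congr_deriv ?_
  simp only [A_eq, Q, div_pow, Real.sq_sqrt zero_le_two, id, Pi.pow_apply, Pi.mul_apply]
  field_simp
  push_cast
  have h2 := Real.cosh_sq y
  grind

lemma wronskian_eq_one (y : ℝ) :
    √2 * (Real.sinh y ^ 2 - 1) / Real.cosh y ^ 3 * A y - A' y * deriv Q y = 1 := by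
  have hc := (Real.cosh_pos y).ne'
  have h2 := Real.cosh_sq y
  have hr := Real.sq_sqrt (zero_le_two (α := ℝ))
  simp only [A_eq, A', deriv_Q]
  field_simp
  rw [hr]
  grind

lemma abs_deriv_Q_le (y : ℝ) : |deriv Q y| ≤ √2 := by
  rw [deriv_Q, abs_neg, abs_div, abs_mul, abs_of_nonneg (Real.sqrt_nonneg 2), abs_pow,
    abs_of_pos (Real.cosh_pos y)]
  refine div_le_of_le_mul₀ (by positivity) (by positivity) ?_
  gcongr
  have := Real.cosh_sq y
  nlinarith [sq_abs (Real.sinh y), sq_nonneg (|Real.sinh y| - 1)]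

lemma hasDerivAt_integral_of_continuousOn_Ici {g : ℝ → ℝ} {a y : ℝ}
    (hg : ContinuousOn g (Set.Ici a)) (hy : a < y) :
    HasDerivAt (fun y => ∫ z in a..y, g z) (g y) y := by
  refine intervalIntegral.integral_hasDerivAt_right ?_ ?_ (hg.continuousAt (Ici_mem_nhds hy))
  · exact (hg.mono (Set.uIcc_of_le hy.le ▸ Set.Icc_subset_Ici_self)).intervalIntegrable
  · exact (hg.mono Set.Ioi_subset_Ici_self).stronglyMeasurableAtFilter isOpen_Ioi y hy

lemma hasDerivAt_integral_Ioi {g : ℝ → ℝ} {a y : ℝ}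
    (hg : ContinuousOn g (Set.Ici a)) (hi : IntegrableOn g (Set.Ioi a)) (hy : a < y) :
    HasDerivAt (fun y => ∫ z in Set.Ioi y, g z) (-g y) y := by
  refine ((hasDerivAt_integral_of_continuousOn_Ici hg hy).const_sub
    (∫ z in Set.Ioi a, g z)).congr_of_eventuallyEq ?_
  filter_upwards [Ioi_mem_nhds hy] with x hx
  rw [← intervalIntegral.integral_Ioi_sub_Ioi hi (le_of_lt hx)]
  ring

lemma contDiffOn_two_of_hasDerivAt {f f' f'' : ℝ → ℝ} {s : Set ℝ} (hs : IsOpen s)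
    (hf : ∀ x ∈ s, HasDerivAt f (f' x) x) (hf' : ∀ x ∈ s, HasDerivAt f' (f'' x) x)
    (hf'' : ContinuousOn f'' s) : ContDiffOn ℝ 2 f s := by
  rw [show (2 : WithTop ℕ∞) = 1 + 1 by norm_num, contDiffOn_succ_iff_deriv_of_isOpen hs]
  refine ⟨fun x hx => (hf x hx).differentiableAt.differentiableWithinAt, by simp, ?_⟩
  refine ContDiffOn.congr (f := f') ?_ fun x hx => (hf x hx).deriv
  rw [show (1 : WithTop ℕ∞) = 0 + 1 by norm_num, contDiffOn_succ_iff_deriv_of_isOpen hs]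
  refine ⟨fun x hx => (hf' x hx).differentiableAt.differentiableWithinAt, by simp, ?_⟩
  exact contDiffOn_zero.2 (hf''.congr fun x hx => (hf' x hx).deriv)

theorem stmt8 (W : ℝ → ℝ) (hWcont : ContinuousOn W (Set.Ici 0))
    (C : ℝ) (hC : 0 < C) (hW : ∀ y : ℝ, 0 ≤ y → |W y| ≤ C * Real.exp (-2 * y))
    (h : ℝ → ℝ)
    (hh : ∀ y : ℝ, h y =
      -(deriv Q y) * (∫ z in (0:ℝ)..y, A z * W z) - A y * ∫ z in Set.Ioi y, deriv Q z * W z) :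
    ContDiffOn ℝ 2 h (Set.Ioi 0) ∧
    ∀ y : ℝ, 0 < y → -(deriv (deriv h) y) + h y - 3 * (Q y) ^ 2 * h y = W y := by
  have hQc : Continuous Q :=
    continuous_iff_continuousAt.2 fun y => (hasDerivAt_Q y).continuousAt
  have hQ'c : Continuous (deriv Q) :=
    continuous_iff_continuousAt.2 fun y => (hasDerivAt_deriv_Q y).continuousAt
  have hAc : Continuous A :=
    continuous_iff_continuousAt.2 fun y => (hasDerivAt_A y).continuousAt
  have hAW : ContinuousOn (fun z => A z * W z) (Set.Ici 0) := hAc.continuousOn.mul hWcont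
  have hQW : ContinuousOn (fun z => deriv Q z * W z) (Set.Ici 0) :=
    hQ'c.continuousOn.mul hWcont
  have hint : IntegrableOn (fun z => deriv Q z * W z) (Set.Ioi 0) := by
    refine Integrable.mono' (((exp_neg_integrableOn_Ioi 0 two_pos).const_mul C).const_mul √2)
      ((hQW.mono Set.Ioi_subset_Ici_self).aestronglyMeasurable measurableSet_Ioi) ?_
    filter_upwards [ae_restrict_mem measurableSet_Ioi] with z hz
    rw [Real.norm_eq_abs, abs_mul]
    exact mul_le_mul (abs_deriv_Q_le z) (hW z (le_of_lt hz)) (abs_nonneg _) (Real.sqrt_nonneg 2)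
  have hI := fun y (hy : 0 < y) => hasDerivAt_integral_of_continuousOn_Ici hAW hy
  have hJ := fun y (hy : 0 < y) => hasDerivAt_integral_Ioi hQW hint hy
  have h₁ : ∀ y ∈ Set.Ioi (0 : ℝ), HasDerivAt h
      (-(√2 * (Real.sinh y ^ 2 - 1) / Real.cosh y ^ 3) * (∫ z in (0:ℝ)..y, A z * W z)
        - A' y * ∫ z in Set.Ioi y, deriv Q z * W z) y := by
    intro y hy
    rw [funext hh]
    refine (((hasDerivAt_deriv_Q y).neg.mul (hI y hy)).sub
      ((hasDerivAt_A y).mul (hJ y hy))).congr_deriv ?_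
    simp only [Pi.neg_apply]
    ring
  have h₂ : ∀ y ∈ Set.Ioi (0 : ℝ), HasDerivAt (fun y =>
      -(√2 * (Real.sinh y ^ 2 - 1) / Real.cosh y ^ 3) * (∫ z in (0:ℝ)..y, A z * W z)
        - A' y * ∫ z in Set.Ioi y, deriv Q z * W z) ((1 - 3 * Q y ^ 2) * h y - W y) y := by
    intro y hy
    refine (((hasDerivAt_deriv_deriv_Q y).neg.mul (hI y hy)).sub
      ((hasDerivAt_A' y).mul (hJ y hy))).congr_deriv ?_
    simp only [Pi.neg_apply, hh y]
    linear_combination -W y * wronskian_eq_one y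
  have hcont : ContinuousOn h (Set.Ioi 0) := fun y hy =>
    (h₁ y hy).continuousAt.continuousWithinAt
  refine ⟨contDiffOn_two_of_hasDerivAt isOpen_Ioi h₁ h₂ ?_, fun y hy => ?_⟩
  · exact ((continuous_const.sub (continuous_const.mul (hQc.pow 2))).continuousOn.mul hcont).sub
      (hWcont.mono Set.Ioi_subset_Ici_self)
  · have hd : deriv (deriv h) y = (1 - 3 * Q y ^ 2) * h y - W y := by
      refine ((h₂ y hy).congr_of_eventuallyEq ?_).deriv
      filter_upwards [Ioi_mem_nhds hy] with x hx using (h₁ x hx).deriv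
    rw [hd]
    ring
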